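/- arXiv:2301.00279 — 2 statements merged into one kernel-verified Lean document; each statement's English description precedes it below -/
import Mathlib

section
/- Let R be a commutative ring. The following are equivalent: (1) every FP-projective R-module is weak w-projective; (2) every finitely presented R-module is weak w-projective; (3) every finitely presented R-module is w-flat; (4) R is von Neumann regular, i.e., for every a ∈ R there exists b ∈ R with a = a b a. -/
/-!  Background definitions for the `w`-operation theory of Wang–Kim–Qiao.  -/

open CategoryTheory

section WTheory

variable (R : Type) [CommRing R]

/-- `J` is a Glaz–Vasconcelos ideal: it is finitely generated and the natural map
`R → Hom_R(J, R)`, sending `r` to multiplication by `r`, is bijective. -/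
def IsGVIdeal (J : Ideal R) : Prop :=
  J.FG ∧ Function.Bijective fun r : R => (r • J.subtype : J →ₗ[R] R)

/-- `M` is `GV`-torsion: every element is annihilated by some GV-ideal. -/
def IsGVTorsion (M : Type*) [AddCommGroup M] [Module R M] : Prop :=
  ∀ x : M, ∃ J : Ideal R, IsGVIdeal R J ∧ ∀ j ∈ J, j • x = 0

/-- `M` is `GV`-torsion-free: no nonzero element is annihilated by a GV-ideal. -/
def IsGVTorsionFree (M : Type*) [AddCommGroup M] [Module R M] : Prop :=
  ∀ x : M, (∃ J : Ideal R, IsGVIdeal R J ∧ ∀ j ∈ J, j • x = 0) → x = 0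

/-- `Ext^n_R(M, N)`, as an `R`-module. -/
noncomputable def extM (M N : Type) [AddCommGroup M] [Module R M]
    [AddCommGroup N] [Module R N] (n : ℕ) : ModuleCat R :=
  ((Ext R (ModuleCat R) n).obj (Opposite.op (ModuleCat.of R M))).obj (ModuleCat.of R N)

/-- `M` is a `w`-module: it is GV-torsion-free and `Ext^1_R(R/J, M) = 0`
for every GV-ideal `J`. -/
def IsWModule (M : Type) [AddCommGroup M] [Module R M] : Prop :=
  IsGVTorsionFree R M ∧
    ∀ J : Ideal R, IsGVIdeal R J → Subsingleton (extM R (R ⧸ J) M 1)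

/-- `(L, ι)` is a `w`-envelope of `M`: `L` is a `w`-module, `ι : M → L` is an injective
linear map, and its cokernel is GV-torsion. -/
def IsWEnvelope (M L : Type) [AddCommGroup M] [Module R M] [AddCommGroup L]
    [Module R L] (ι : M →ₗ[R] L) : Prop :=
  IsWModule R L ∧ Function.Injective ι ∧ IsGVTorsion R (L ⧸ LinearMap.range ι)

/-- The GV-torsion submodule `tor_GV(M)`.  (The displayed generating set is already closed
under the module operations, since the GV-ideals form a multiplicative system of ideals,
so the span coincides with the displayed set.) -/
def torGV (M : Type) [AddCommGroup M] [Module R M] : Submodule R M :=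
  Submodule.span R {x : M | ∃ J : Ideal R, IsGVIdeal R J ∧ ∀ j ∈ J, j • x = 0}

/-- `M` is `w`-projective: for every GV-torsion-free `w`-module `N` and every
`w`-envelope `(L, ι)` of `M / tor_GV(M)`, the module `Ext^1_R(L, N)` is GV-torsion. -/
def IsWProjective (M : Type) [AddCommGroup M] [Module R M] : Prop :=
  ∀ (N : Type) [AddCommGroup N] [Module R N], IsGVTorsionFree R N → IsWModule R N →
    ∀ (L : Type) [AddCommGroup L] [Module R L] (ι : (M ⧸ torGV R M) →ₗ[R] L),
      IsWEnvelope R (M ⧸ torGV R M) L ι → IsGVTorsion R (extM R L N 1)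

/-- `N` belongs to the class `P_w^{†∞}`: it is GV-torsion-free and
`Ext^k_R(M, N) = 0` for every `w`-projective `M` and every `k ≥ 1`. -/
def MemPwDaggerInfty (N : Type) [AddCommGroup N] [Module R N] : Prop :=
  IsGVTorsionFree R N ∧
    ∀ (M : Type) [AddCommGroup M] [Module R M], IsWProjective R M →
      ∀ k : ℕ, 1 ≤ k → Subsingleton (extM R M N k)

/-- `M` is weak `w`-projective: `Ext^1_R(M, N) = 0` for every `N ∈ P_w^{†∞}`. -/
def IsWeakWProjective (M : Type) [AddCommGroup M] [Module R M] : Prop :=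
  ∀ (N : Type) [AddCommGroup N] [Module R N], MemPwDaggerInfty R N →
    Subsingleton (extM R M N 1)

end WTheory

section WExactness

variable (R : Type) [CommRing R]

/-- `I` is a `w`-ideal of `R`. -/
def IsWIdeal (I : Ideal R) : Prop :=
  ∀ x : R, (∃ J : Ideal R, IsGVIdeal R J ∧ ∀ j ∈ J, j * x ∈ I) → x ∈ I

/-- `P` is a maximal `w`-ideal: it is maximal among proper `w`-ideals of `R`.
(Every maximal `w`-ideal is a prime ideal.) -/
def IsMaxWIdeal (P : Ideal R) : Prop :=
  IsWIdeal R P ∧ P ≠ ⊤ ∧ ∀ I : Ideal R, IsWIdeal R I → I ≠ ⊤ → P ≤ I → I = P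

/-- The localization of a linear map at a submonoid. -/
noncomputable def locMap (S : Submonoid R) {A B : Type} [AddCommGroup A] [Module R A]
    [AddCommGroup B] [Module R B] (f : A →ₗ[R] B) :
    LocalizedModule S A →ₗ[R] LocalizedModule S B :=
  IsLocalizedModule.map S (LocalizedModule.mkLinearMap S A) (LocalizedModule.mkLinearMap S B) f

/-- `f` is a `w`-monomorphism: its localization at every maximal `w`-ideal is injective. -/
def IsWMono {A B : Type} [AddCommGroup A] [Module R A] [AddCommGroup B] [Module R B]
    (f : A →ₗ[R] B) : Prop :=
  ∀ (P : Ideal R), IsMaxWIdeal R P → ∀ [P.IsPrime],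
    Function.Injective (locMap R P.primeCompl f)

/-- `f` is a `w`-epimorphism: its localization at every maximal `w`-ideal is surjective. -/
def IsWEpi {A B : Type} [AddCommGroup A] [Module R A] [AddCommGroup B] [Module R B]
    (f : A →ₗ[R] B) : Prop :=
  ∀ (P : Ideal R), IsMaxWIdeal R P → ∀ [P.IsPrime],
    Function.Surjective (locMap R P.primeCompl f)

/-- `0 → A → B → C → 0` is a `w`-exact sequence: its localization at every maximal
`w`-ideal is a short exact sequence. -/
def IsWShortExact {A B C : Type} [AddCommGroup A] [Module R A] [AddCommGroup B] [Module R B]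
    [AddCommGroup C] [Module R C] (f : A →ₗ[R] B) (g : B →ₗ[R] C) : Prop :=
  ∀ (P : Ideal R), IsMaxWIdeal R P → ∀ [P.IsPrime],
    Function.Injective (locMap R P.primeCompl f) ∧
    Function.Exact (locMap R P.primeCompl f) (locMap R P.primeCompl g) ∧
    Function.Surjective (locMap R P.primeCompl g)

/-- `M` is of finite type: there is a `w`-epimorphism from a finitely generated free module. -/
def IsFiniteType (M : Type) [AddCommGroup M] [Module R M] : Prop :=
  ∃ (n : ℕ) (g : (Fin n → R) →ₗ[R] M), IsWEpi R g

/-- `M` is of finitely presented type: there is a `w`-exact sequence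
`F₁ → F₀ → M → 0` with `F₁`, `F₀` finitely generated free. -/
def IsFinitelyPresentedType (M : Type) [AddCommGroup M] [Module R M] : Prop :=
  ∃ (m n : ℕ) (f : (Fin m → R) →ₗ[R] (Fin n → R)) (g : (Fin n → R) →ₗ[R] M),
    IsWEpi R g ∧ ∀ (P : Ideal R), IsMaxWIdeal R P → ∀ [P.IsPrime],
      Function.Exact (locMap R P.primeCompl f) (locMap R P.primeCompl g)

/-- `M` is `w`-flat: tensoring with `M` preserves `w`-monomorphisms. -/
def IsWFlat (M : Type) [AddCommGroup M] [Module R M] : Prop :=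
  ∀ (A B : Type) [AddCommGroup A] [Module R A] [AddCommGroup B] [Module R B]
    (f : A →ₗ[R] B), IsWMono R f → IsWMono R (LinearMap.lTensor M f)

end WExactness

/-- `A` is absolutely pure (FP-injective): `Ext^1_R(F, A) = 0` for every finitely
presented `R`-module `F`. -/
def IsAbsolutelyPure (R : Type) [CommRing R] (A : Type) [AddCommGroup A] [Module R A] : Prop :=
  ∀ (F : Type) [AddCommGroup F] [Module R F], Module.FinitePresentation R F →
    Subsingleton (extM R F A 1)

/-- `M` is FP-projective: `Ext^1_R(M, N) = 0` for every absolutely pure `R`-module `N`. -/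
def IsFPProjective (R : Type) [CommRing R] (M : Type) [AddCommGroup M] [Module R M] : Prop :=
  ∀ (N : Type) [AddCommGroup N] [Module R N], IsAbsolutelyPure R N →
    Subsingleton (extM R M N 1)

section Resolution

variable {R : Type} [CommRing R]

/-- A linear map whose kernel contains the kernel of `u` factors through the range of `u`. -/
lemma exists_factor_range {X Y Z : Type} [AddCommGroup X] [Module R X] [AddCommGroup Y]
    [Module R Y] [AddCommGroup Z] [Module R Z] (u : X →ₗ[R] Y) (g : X →ₗ[R] Z)
    (h : ∀ x, u x = 0 → g x = 0) :
    ∃ k : LinearMap.range u →ₗ[R] Z, ∀ x, k ⟨u x, x, rfl⟩ = g x := by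
  refine ⟨(LinearMap.ker u).liftQ g (fun x hx => h x hx) ∘ₗ u.quotKerEquivRange.symm.toLinearMap,
    fun x => ?_⟩
  have : u.quotKerEquivRange.symm ⟨u x, x, rfl⟩ = (LinearMap.ker u).mkQ x := by
    rw [LinearEquiv.symm_apply_eq]
    rfl
  rw [LinearMap.comp_apply, LinearEquiv.coe_coe, this]
  exact (LinearMap.ker u).liftQ_apply g x

lemma exists_factor_of_surjective {X Y Z : Type} [AddCommGroup X] [Module R X] [AddCommGroup Y]
    [Module R Y] [AddCommGroup Z] [Module R Z] (u : X →ₗ[R] Y) (hu : Function.Surjective u)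
    (g : X →ₗ[R] Z) (h : ∀ x, u x = 0 → g x = 0) :
    ∃ k : Y →ₗ[R] Z, ∀ x, k (u x) = g x := by
  obtain ⟨k, hk⟩ := exists_factor_range u g h
  exact ⟨k ∘ₗ LinearMap.codRestrict _ LinearMap.id fun y => hu y, hk⟩

variable {M : Type} [AddCommGroup M] [Module R M] (P : ProjectiveResolution (ModuleCat.of R M))
  (N : Type) [AddCommGroup N] [Module R N]

/-- `Ext^{n+1}` as the homology of the complex of maps out of a projective resolution. -/
noncomputable def homComplexHomologyIso (n : ℕ) :
    extM R M N (n + 1) ≅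
      ((P.complex.linearYonedaObj R (ModuleCat.of R N)).sc' n (n + 1) (n + 2)).homology :=
  P.isoExt (n + 1) (ModuleCat.of R N) ≪≫
    (P.complex.linearYonedaObj R (ModuleCat.of R N)).homologyIsoSc' n (n + 1) (n + 2)
      (by simp) (by simp)

lemma subsingleton_extM_succ (n : ℕ)
    (h : ∀ φ : P.complex.X (n + 1) →ₗ[R] N, φ ∘ₗ (P.complex.d (n + 2) (n + 1)).hom = 0 →
      ∃ ψ : P.complex.X n →ₗ[R] N, ψ ∘ₗ (P.complex.d (n + 1) n).hom = φ) :
    Subsingleton (extM R M N (n + 1)) := by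
  refine ModuleCat.subsingleton_of_isZero (Limits.IsZero.of_iso ?_ (homComplexHomologyIso P N n))
  rw [← ShortComplex.exact_iff_isZero_homology, ShortComplex.moduleCat_exact_iff]
  intro φ hφ
  obtain ⟨ψ, hψ⟩ := h (ModuleCat.Hom.hom φ) (by
    exact congrArg ModuleCat.Hom.hom hφ)
  exact ⟨ModuleCat.ofHom ψ, ModuleCat.hom_ext hψ⟩

lemma exists_smul_eq_comp_of_extM (n : ℕ) (φ : P.complex.X (n + 1) →ₗ[R] N)
    (hφ : φ ∘ₗ (P.complex.d (n + 2) (n + 1)).hom = 0) :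
    ∃ z : extM R M N (n + 1), ∀ r : R, r • z = 0 →
      ∃ ψ : P.complex.X n →ₗ[R] N, ψ ∘ₗ (P.complex.d (n + 1) n).hom = r • φ := by
  let S := (P.complex.linearYonedaObj R (ModuleCat.of R N)).sc' n (n + 1) (n + 2)
  let φ' : LinearMap.ker S.g.hom := ⟨ModuleCat.ofHom φ, ModuleCat.hom_ext hφ⟩
  let e : extM R M N (n + 1) ≅ S.moduleCatLeftHomologyData.H :=
    homComplexHomologyIso P N n ≪≫ S.moduleCatHomologyIso
  refine ⟨e.inv.hom (Submodule.Quotient.mk φ'), fun r hr => ?_⟩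
  have h1 : e.inv.hom (r • Submodule.Quotient.mk φ') = e.inv.hom 0 :=
    ((map_smul e.inv.hom r _).trans hr).trans (map_zero _).symm
  have h2 := (ModuleCat.mono_iff_injective e.inv).1 inferInstance h1
  obtain ⟨ψ, hψ⟩ := (Submodule.Quotient.mk_eq_zero (LinearMap.range S.moduleCatToCycles)
    (x := r • φ')).1 h2
  exact ⟨ModuleCat.Hom.hom ψ, congrArg (fun q => ModuleCat.Hom.hom (Subtype.val q)) hψ⟩

/-- The augmentation of a projective resolution, as a linear map. -/
noncomputable def augmentation : P.complex.X 0 →ₗ[R] M := ModuleCat.Hom.hom (P.π.f 0)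

lemma augmentation_surjective : Function.Surjective (augmentation P) :=
  (ModuleCat.epi_iff_surjective (P.π.f 0)).1 inferInstance

lemma range_d_zero : LinearMap.range (P.complex.d 1 0).hom = LinearMap.ker (augmentation P) :=
  (ShortComplex.moduleCat_exact_iff_range_eq_ker _).1 P.exact₀

lemma range_d_succ (n : ℕ) : LinearMap.range (P.complex.d (n + 2) (n + 1)).hom =
    LinearMap.ker (P.complex.d (n + 1) n).hom :=
  (ShortComplex.moduleCat_exact_iff_range_eq_ker _).1 (P.exact_succ n)

instance projective_complex (n : ℕ) : Module.Projective R (P.complex.X n) :=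
  (IsProjective.iff_projective _).2 (P.projective n)

/-- `Ext^{n+1}` vanishes as soon as maps from the `n`-th syzygy extend. -/
lemma subsingleton_extM_of_extend (n : ℕ)
    (h : ∀ f : LinearMap.range (P.complex.d (n + 1) n).hom →ₗ[R] N,
      ∃ ψ : P.complex.X n →ₗ[R] N, ∀ x, ψ x.1 = f x) :
    Subsingleton (extM R M N (n + 1)) := by
  refine subsingleton_extM_succ P N n fun φ hφ => ?_
  obtain ⟨f, hf⟩ := exists_factor_range (P.complex.d (n + 1) n).hom φ (by
    intro x hx
    have hx' : x ∈ LinearMap.range (P.complex.d (n + 2) (n + 1)).hom := by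
      rw [range_d_succ]; exact hx
    obtain ⟨y, rfl⟩ := hx'
    exact LinearMap.congr_fun hφ y)
  obtain ⟨ψ, hψ⟩ := h f
  exact ⟨ψ, LinearMap.ext fun x => (hψ ⟨_, x, rfl⟩).trans (hf x)⟩

/-- If `r` annihilates a suitable class in `Ext^1`, then `r` times a map from the first syzygy
extends. -/
lemma exists_extend_smul (f : LinearMap.ker (augmentation P) →ₗ[R] N) :
    ∃ z : extM R M N 1, ∀ r : R, r • z = 0 →
      ∃ ψ : P.complex.X 0 →ₗ[R] N, ∀ x, ψ x.1 = r • f x := by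
  let d : P.complex.X 1 →ₗ[R] LinearMap.ker (augmentation P) :=
    (P.complex.d 1 0).hom.codRestrict _ fun x => by
      rw [← range_d_zero]; exact ⟨x, rfl⟩
  obtain ⟨z, hz⟩ := exists_smul_eq_comp_of_extM P N 0 (f ∘ₗ d) (by
    ext x
    have : d ((P.complex.d 2 1).hom x) = 0 := Subtype.ext (by
      have : (P.complex.d 2 1).hom x ∈ LinearMap.ker (P.complex.d 1 0).hom := by
        rw [← range_d_succ]; exact ⟨x, rfl⟩
      exact this)
    exact (congrArg f this).trans (map_zero f))
  refine ⟨z, fun r hr => ?_⟩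
  obtain ⟨ψ, hψ⟩ := hz r hr
  refine ⟨ψ, fun x => ?_⟩
  have hx : x.1 ∈ LinearMap.range (P.complex.d 1 0).hom := by rw [range_d_zero]; exact x.2
  obtain ⟨y, hy⟩ := hx
  have hy' : d y = x := Subtype.ext hy
  rw [← hy, ← hy']
  exact LinearMap.congr_fun hψ y

end Resolution

section GVIdeal

variable {R : Type} [CommRing R]

lemma IsGVIdeal.eq_zero {J : Ideal R} (hJ : IsGVIdeal R J) {r : R} (h : ∀ j ∈ J, r * j = 0) :
    r = 0 :=
  hJ.2.1 (LinearMap.ext fun j => by simpa using h j j.2)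

lemma IsGVIdeal.exists_mul_eq {J : Ideal R} (hJ : IsGVIdeal R J) (f : J →ₗ[R] R) :
    ∃ c : R, ∀ j : J, f j = c * j := by
  obtain ⟨c, hc⟩ := hJ.2.2 f
  exact ⟨c, fun j => by simp [← hc]⟩

lemma IsGVIdeal.of_fg {J : Ideal R} (hfg : J.FG)
    (h0 : ∀ r : R, (∀ j ∈ J, r * j = 0) → r = 0)
    (h1 : ∀ f : J →ₗ[R] R, ∃ c : R, ∀ j : J, f j = c * j) : IsGVIdeal R J := by
  refine ⟨hfg, fun r s hrs => sub_eq_zero.1 (h0 _ fun j hj => ?_), fun f => ?_⟩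
  · have := LinearMap.congr_fun hrs ⟨j, hj⟩
    simp only [LinearMap.smul_apply, Submodule.subtype_apply, smul_eq_mul] at this
    rw [sub_mul, this, sub_self]
  · obtain ⟨c, hc⟩ := h1 f
    exact ⟨c, LinearMap.ext fun j => by simp [hc]⟩

lemma IsGVIdeal.mul {J K : Ideal R} (hJ : IsGVIdeal R J) (hK : IsGVIdeal R K) :
    IsGVIdeal R (J * K) := by
  refine IsGVIdeal.of_fg (hJ.1.mul hK.1) (fun r hr => ?_) fun f => ?_
  · refine hK.eq_zero fun k hk => hJ.eq_zero fun j hj => ?_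
    rw [mul_assoc, mul_comm k]
    exact hr _ (Ideal.mul_mem_mul hj hk)
  · have hg (k : K) : ∃ c : R, ∀ j : J, f ⟨j * k, Ideal.mul_mem_mul j.2 k.2⟩ = c * j :=
      hJ.exists_mul_eq
        { toFun := fun j => f ⟨j * k, Ideal.mul_mem_mul j.2 k.2⟩
          map_add' := fun x y => by
            rw [← map_add]; congr 1; ext; simp [add_mul]
          map_smul' := fun r x => by
            rw [← map_smul]; congr 1; ext; simp [mul_assoc] }
    choose g hg using hg
    obtain ⟨c, hc⟩ := hK.exists_mul_eq
      { toFun := g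
        map_add' := fun x y => sub_eq_zero.1 <| hJ.eq_zero fun j hj => by
          have h1 := hg (x + y) ⟨j, hj⟩
          have h2 := hg x ⟨j, hj⟩
          have h3 := hg y ⟨j, hj⟩
          rw [sub_mul, add_mul, ← h1, ← h2, ← h3, sub_eq_zero, ← map_add]
          congr 1; ext; simp [mul_add]
        map_smul' := fun r x => sub_eq_zero.1 <| hJ.eq_zero fun j hj => by
          have h1 := hg (r • x) ⟨j, hj⟩
          have h2 := hg x ⟨j, hj⟩
          rw [sub_mul, RingHom.id_apply, smul_eq_mul, mul_assoc, ← h1, ← h2, sub_eq_zero,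
            ← smul_eq_mul r, ← map_smul]
          congr 1; ext; simp only [Submodule.coe_smul, smul_eq_mul]; ring }
    refine ⟨c, fun ⟨x, hx⟩ => ?_⟩
    induction hx using Submodule.mul_induction_on' with
    | mem_mul_mem j hj k hk =>
      have h1 := hg ⟨k, hk⟩ ⟨j, hj⟩
      have h2 : g ⟨k, hk⟩ = c * k := hc ⟨k, hk⟩
      exact h1.trans (by rw [h2]; ring)
    | add x hx y hy h1 h2 =>
      have h3 := map_add f ⟨x, hx⟩ ⟨y, hy⟩
      rw [h1, h2] at h3
      exact h3.trans (mul_add c x y).symm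

lemma IsMaxWIdeal.not_le {P : Ideal R} (hP : IsMaxWIdeal R P) {J : Ideal R}
    (hJ : IsGVIdeal R J) : ∃ s ∈ J, s ∉ P := by
  by_contra! h
  refine hP.2.1 ((Ideal.eq_top_iff_one _).2 (hP.1 1 ⟨J, hJ, fun j hj => ?_⟩))
  rw [mul_one]
  exact h j hj

lemma IsMaxWIdeal.isPrime {P : Ideal R} (hP : IsMaxWIdeal R P) : P.IsPrime := by
  refine ⟨hP.2.1, fun {a b} hab => or_iff_not_imp_left.2 fun ha => ?_⟩
  have h : P.colon {a} = P := by
    refine hP.2.2 _ (fun x => ?_) (fun h => ha ?_) fun x hx => ?_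
    · rintro ⟨J, hJ, hx⟩
      refine Submodule.mem_colon_singleton.2 (hP.1 _ ⟨J, hJ, fun j hj => ?_⟩)
      have := Submodule.mem_colon_singleton.1 (hx j hj)
      rwa [smul_eq_mul, mul_assoc] at this
    · have h1 : (1 : R) ∈ P.colon {a} := h ▸ Submodule.mem_top
      simpa using Submodule.mem_colon_singleton.1 h1
    · exact Submodule.mem_colon_singleton.2 (P.mul_mem_right a hx)
  rw [← h]
  exact Submodule.mem_colon_singleton.2 (by rwa [smul_eq_mul, mul_comm])

/-- An ideal contained in no maximal `w`-ideal contains a GV-ideal. -/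
lemma exists_isGVIdeal_le (I : Ideal R) (h : ∀ P, IsMaxWIdeal R P → ∃ s ∈ I, s ∉ P) :
    ∃ J, IsGVIdeal R J ∧ J ≤ I := by
  by_contra! hI
  have hchain (c : Set (Ideal R)) (hc : ∀ I ∈ c, ∀ J, IsGVIdeal R J → ¬ J ≤ I)
      (hchain : IsChain (· ≤ ·) c) (y : Ideal R) (hy : y ∈ c) (J : Ideal R)
      (hJ : IsGVIdeal R J) : ¬ J ≤ sSup c := fun hle => by
    obtain ⟨x, hx, hJx⟩ := (CompleteLattice.isCompactElement_iff_le_of_directed_sSup_le _ J).1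
      ((Submodule.fg_iff_compact J).1 hJ.1) c ⟨y, hy⟩ hchain.directedOn hle
    exact hc x hx J hJ hJx
  obtain ⟨P, hIP, hP⟩ := zorn_le_nonempty₀ {I : Ideal R | ∀ J, IsGVIdeal R J → ¬ J ≤ I}
    (fun c hc hc' y hy => ⟨sSup c, hchain c hc hc' y hy, fun z hz => le_sSup hz⟩) I hI
  have hw : IsWIdeal R P := by
    rintro x ⟨J, hJ, hx⟩
    by_contra hxP
    have h1 : ¬ P ⊔ Ideal.span {x} ≤ P := fun h2 =>
      hxP (h2 (Submodule.mem_sup_right (Ideal.mem_span_singleton_self x)))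
    have h2 : P ⊔ Ideal.span {x} ∉ {I : Ideal R | ∀ J, IsGVIdeal R J → ¬ J ≤ I} :=
      fun h3 => h1 (hP.2 h3 le_sup_left)
    simp only [Set.mem_ofPred_eq, not_forall, not_not] at h2
    obtain ⟨K, hK, hKP⟩ := h2
    refine hP.1 _ (hJ.mul hK) (Ideal.mul_le.2 fun j hj k hk => ?_)
    obtain ⟨p, hp, q, hq, rfl⟩ := Submodule.mem_sup.1 (hKP hk)
    obtain ⟨r, rfl⟩ := Ideal.mem_span_singleton'.1 hq
    rw [mul_add, mul_left_comm]
    exact P.add_mem (P.mul_mem_left _ hp) (P.mul_mem_left _ (hx j hj))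
  have htop : IsGVIdeal R (⊤ : Ideal R) := by
    refine IsGVIdeal.of_fg Module.Finite.fg_top (fun r hr => by simpa using hr 1 trivial)
      fun f => ⟨f ⟨1, trivial⟩, fun j => ?_⟩
    rw [mul_comm, ← smul_eq_mul, ← map_smul]
    congr 1; ext; simp
  have hmax : IsMaxWIdeal R P := by
    refine ⟨hw, fun h1 => hP.1 _ htop h1.ge, fun K hK hKtop hPK => ?_⟩
    refine le_antisymm (hP.2 (fun J hJ hJK => hKtop ?_) hPK) hPK
    exact (Ideal.eq_top_iff_one _).2 (hK 1 ⟨J, hJ, fun j hj => by simpa using hJK hj⟩)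
  obtain ⟨s, hs, hsP⟩ := h P hmax
  exact hsP (hIP hs)

/-- If every element is locally, at the maximal `w`-ideals, in the ideal generated by its square,
then the ring is von Neumann regular. -/
lemma exists_eq_mul_mul_self (a : R)
    (h : ∀ P, IsMaxWIdeal R P → ∃ s, s ∉ P ∧ ∃ t, s * a = a ^ 2 * t) : ∃ b, a = a * b * a := by
  obtain ⟨J, hJ, hle⟩ := exists_isGVIdeal_le ((Ideal.span {a ^ 2}).colon {a}) (fun P hP => by
    obtain ⟨s, hs, t, ht⟩ := h P hP
    exact ⟨s, Submodule.mem_colon_singleton.2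
      (Ideal.mem_span_singleton.2 ⟨t, by rw [smul_eq_mul, ht]⟩), hs⟩)
  have key (u v u' : R) (huv : ∀ j ∈ J, ∃ r, j * u = v * r) (hv : ∀ x, v * x = 0 → u' * x = 0) :
      ∃ c, (∀ j ∈ J, ∃ r, j * u = v * r ∧ u' * r = c * j) ∧ v * c = u' * u := by
    choose! r hr using huv
    have hu (x y : R) (hxy : v * x = v * y) : u' * x = u' * y :=
      sub_eq_zero.1 <| by
        rw [← mul_sub]; exact hv _ (by rw [mul_sub, hxy, sub_self])
    obtain ⟨c, hc⟩ := hJ.exists_mul_eq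
      { toFun := fun j => u' * r j
        map_add' := fun x y => by
          rw [← mul_add]
          refine hu _ _ ?_
          rw [mul_add, ← hr _ x.2, ← hr _ y.2, ← hr _ (x + y).2, Submodule.coe_add, add_mul]
        map_smul' := fun t x => by
          rw [RingHom.id_apply, smul_eq_mul, mul_left_comm]
          refine hu _ _ ?_
          rw [mul_left_comm, ← hr _ x.2, ← hr _ (t • x).2, Submodule.coe_smul, smul_eq_mul,
            mul_assoc] }
    refine ⟨c, fun j hj => ⟨r j, hr j hj, hc ⟨j, hj⟩⟩, sub_eq_zero.1 (hJ.eq_zero fun j hj => ?_)⟩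
    have h1 : u' * r j = c * j := hc ⟨j, hj⟩
    have h2 := hr j hj
    linear_combination -v * h1 - u' * h2
  have h1 (j : R) (hj : j ∈ J) : ∃ r, j * a = a ^ 2 * r :=
    Ideal.mem_span_singleton.1 (Submodule.mem_colon_singleton.1 (hle hj))
  have h2 (x : R) (hx : a ^ 2 * x = 0) : a * x = 0 := hJ.eq_zero fun j hj => by
    obtain ⟨r, hr⟩ := h1 j hj
    linear_combination x * hr + r * hx
  obtain ⟨e, hej, he⟩ := key a (a ^ 2) a h1 h2
  have hae : a * (e - 1) = 0 := h2 _ (by linear_combination he)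
  obtain ⟨c, -, hc⟩ := key e a e
    (fun j hj => by
      obtain ⟨r, -, hr⟩ := hej j hj
      exact ⟨r, by rw [hr, mul_comm]⟩)
    (fun x hx => hJ.eq_zero fun j hj => by
      obtain ⟨r, -, hr⟩ := hej j hj
      linear_combination r * hx - x * hr)
  exact ⟨c, by linear_combination -(e + 1) * hae - a * hc⟩

end GVIdeal

section LocalModules

variable {R : Type} [CommRing R]

/-- Every element of `S` acts invertibly on `N`. -/
def ActsInvertibly (S : Submonoid R) (N : Type) [AddCommGroup N] [Module R N] : Prop :=
  ∀ s : S, IsUnit (algebraMap R (Module.End R N) s)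

namespace ActsInvertibly

variable {S : Submonoid R} {N : Type} [AddCommGroup N] [Module R N]

lemma smul_injective (h : ActsInvertibly S N) {s : R} (hs : s ∈ S) {x y : N}
    (hxy : s • x = s • y) : x = y :=
  ((Module.End.isUnit_iff _).1 (h ⟨s, hs⟩)).1 hxy

lemma exists_inv (h : ActsInvertibly S N) {s : R} (hs : s ∈ S) :
    ∃ u : N →ₗ[R] N, ∀ x, u (s • x) = x ∧ s • u x = x := by
  obtain ⟨e, he⟩ := h ⟨s, hs⟩
  have he' (x : N) : s • x = e.1 x := by rw [he]; rfl
  refine ⟨e⁻¹.1, fun x => ⟨?_, ?_⟩⟩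
  · rw [he']
    exact LinearMap.congr_fun e.inv_mul x
  · rw [he']
    exact LinearMap.congr_fun e.mul_inv x

/-- A map into a local module extends along an inclusion whose cokernel is annihilated by an
invertible element. -/
lemma exists_extend (h : ActsInvertibly S N) {Q : Type} [AddCommGroup Q] [Module R Q]
    (K : Submodule R Q) {s : R} (hs : s ∈ S) (hK : ∀ x, s • x ∈ K) (f : K →ₗ[R] N) :
    ∃ ψ : Q →ₗ[R] N, ∀ x : K, ψ x = f x := by
  obtain ⟨u, hu⟩ := h.exists_inv hs
  refine ⟨u ∘ₗ f ∘ₗ (s • LinearMap.id).codRestrict K hK, fun x => ?_⟩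
  have : (s • LinearMap.id : Q →ₗ[R] Q).codRestrict K hK x = s • x := Subtype.ext (by simp)
  simp [this, (hu _).1]

lemma ker (hN : ActsInvertibly S N) {N' : Type} [AddCommGroup N'] [Module R N']
    (hN' : ActsInvertibly S N') (p : N →ₗ[R] N') : ActsInvertibly S (LinearMap.ker p) := by
  refine fun s => (Module.End.isUnit_iff _).2 ⟨fun x y hxy => Subtype.ext ?_, fun x => ?_⟩
  · exact hN.smul_injective s.2 (congrArg Subtype.val hxy)
  · obtain ⟨u, hu⟩ := hN.exists_inv s.2
    refine ⟨⟨u x, hN'.smul_injective s.2 ?_⟩, Subtype.ext (hu x.1).2⟩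
    rw [← map_smul, (hu x.1).2, smul_zero]
    exact x.2

end ActsInvertibly

lemma actsInvertibly_localizedModule (S : Submonoid R) (M : Type) [AddCommGroup M] [Module R M] :
    ActsInvertibly S (LocalizedModule S M) :=
  IsLocalizedModule.map_units (LocalizedModule.mkLinearMap S M)

/-- Maps from `M` lift along surjections of modules on which `S` acts invertibly; equivalently,
the localization of `M` at `S` is projective. -/
def HasLocalLifting (S : Submonoid R) (M : Type) [AddCommGroup M] [Module R M] : Prop :=
  ∀ (A B : Type) [AddCommGroup A] [Module R A] [AddCommGroup B] [Module R B],
    ActsInvertibly S A → ActsInvertibly S B → ∀ p : A →ₗ[R] B, Function.Surjective p →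
      ∀ h : M →ₗ[R] B, ∃ g : M →ₗ[R] A, ∀ x, p (g x) = h x

section

variable {S : Submonoid R} {M : Type} [AddCommGroup M] [Module R M]
  {Q : Type} [AddCommGroup Q] [Module R Q]

/-- Maps from the kernel of a presentation of a locally projective module to a local module
extend. -/
lemma HasLocalLifting.exists_extend (hM : HasLocalLifting S M) (π : Q →ₗ[R] M)
    (hπ : Function.Surjective π) {N : Type} [AddCommGroup N] [Module R N]
    (hN : ActsInvertibly S N) (f : LinearMap.ker π →ₗ[R] N) :
    ∃ ψ : Q →ₗ[R] N, ∀ x : LinearMap.ker π, ψ x = f x := by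
  let lK := LocalizedModule.mkLinearMap S (LinearMap.ker π)
  let lQ := LocalizedModule.mkLinearMap S Q
  let lM := LocalizedModule.mkLinearMap S M
  let i := IsLocalizedModule.map S lK lQ (LinearMap.ker π).subtype
  let p := IsLocalizedModule.map S lQ lM π
  have hi : Function.Injective i :=
    IsLocalizedModule.map_injective S lK lQ _ Subtype.val_injective
  have hp : Function.Surjective p := IsLocalizedModule.map_surjective S lQ lM π hπ
  have hex : Function.Exact i p :=
    IsLocalizedModule.map_exact S lK lQ lM _ _ fun x => by simp
  obtain ⟨σ, hσ⟩ := hM _ _ (actsInvertibly_localizedModule S Q)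
    (actsInvertibly_localizedModule S M) p hp lM
  let ρ : Q →ₗ[R] LinearMap.range i := (lQ - σ ∘ₗ π).codRestrict _ fun x => by
    refine (hex _).1 ?_
    rw [LinearMap.sub_apply, map_sub, LinearMap.comp_apply, hσ, IsLocalizedModule.map_apply,
      sub_self]
  refine ⟨IsLocalizedModule.lift S lK f hN ∘ₗ
    (LinearEquiv.ofInjective i hi).symm.toLinearMap ∘ₗ ρ, fun x => ?_⟩
  have : (LinearEquiv.ofInjective i hi).symm (ρ x) = lK x := by
    rw [LinearEquiv.symm_apply_eq]
    refine Subtype.ext ?_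
    have hx : π x = 0 := x.2
    have h1 : i (lK x) = lQ x := IsLocalizedModule.map_apply S lK lQ _ x
    have h2 : (ρ x).1 = lQ x - σ (π x) := rfl
    rw [h2, hx, map_zero, sub_zero]
    exact h1.symm
  rw [LinearMap.comp_apply, LinearMap.comp_apply, LinearEquiv.coe_coe, this]
  exact IsLocalizedModule.lift_apply S lK f hN x

lemma HasLocalLifting.ker (hM : HasLocalLifting S M) [Module.Projective R Q] (π : Q →ₗ[R] M)
    (hπ : Function.Surjective π) : HasLocalLifting S (LinearMap.ker π) := by
  intro A B _ _ _ _ hA hB p hp h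
  obtain ⟨ψ, hψ⟩ := hM.exists_extend π hπ hB h
  obtain ⟨g, hg⟩ := Module.projective_lifting_property p ψ hp
  refine ⟨g ∘ₗ (LinearMap.ker π).subtype, fun x => ?_⟩
  rw [← hψ, ← hg]
  rfl

/-- Local projectivity from the extension property for one projective presentation. -/
lemma hasLocalLifting_of_extend [Module.Projective R Q] (π : Q →ₗ[R] M)
    (hπ : Function.Surjective π)
    (h : ∀ (N : Type) [AddCommGroup N] [Module R N], ActsInvertibly S N →
      ∀ f : LinearMap.ker π →ₗ[R] N, ∃ ψ : Q →ₗ[R] N, ∀ x : LinearMap.ker π, ψ x = f x) :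
    HasLocalLifting S M := by
  intro A B _ _ _ _ hA hB p hp k
  obtain ⟨g, hg⟩ := Module.projective_lifting_property p (k ∘ₗ π) hp
  have hg' (x : Q) : p (g x) = k (π x) := LinearMap.congr_fun hg x
  obtain ⟨ψ, hψ⟩ := h _ (hA.ker hB p) ((g ∘ₗ (LinearMap.ker π).subtype).codRestrict _ fun x => by
    have hx : π x = 0 := x.2
    simp [hg', hx])
  obtain ⟨l, hl⟩ := exists_factor_of_surjective π hπ (g - (LinearMap.ker p).subtype ∘ₗ ψ)
    fun x hx => by
      have : (ψ x).1 = g x := congrArg Subtype.val (hψ ⟨x, hx⟩)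
      simp [this]
  refine ⟨l, fun y => ?_⟩
  obtain ⟨x, rfl⟩ := hπ y
  have h0 : p (ψ x).1 = 0 := (ψ x).2
  rw [hl, ← hg', LinearMap.sub_apply, map_sub, LinearMap.comp_apply, Submodule.subtype_apply, h0,
    sub_zero]

/-- Local projectivity descends along maps that are isomorphisms after localization. -/
lemma HasLocalLifting.of_map {L : Type} [AddCommGroup L] [Module R L] (hL : HasLocalLifting S L)
    (u : M →ₗ[R] L) (hker : ∀ x, u x = 0 → ∃ s ∈ S, s • x = 0)
    (hcoker : ∀ y, ∃ s ∈ S, ∃ x, s • y = u x) : HasLocalLifting S M := by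
  intro A B _ _ _ _ hA hB p hp h
  let l := LocalizedModule.mkLinearMap S L
  have : IsLocalizedModule S (l ∘ₗ u) :=
    { map_units := IsLocalizedModule.map_units l
      surj := fun y => by
        obtain ⟨⟨z, s⟩, hz⟩ := IsLocalizedModule.surj S l y
        obtain ⟨t, ht, x, hx⟩ := hcoker z
        refine ⟨⟨x, ⟨t, ht⟩ * s⟩, ?_⟩
        rw [mul_smul, hz, LinearMap.comp_apply, ← hx, map_smul]
        rfl
      exists_of_eq := fun {x y} hxy => by
        obtain ⟨s, hs⟩ := IsLocalizedModule.exists_of_eq (S := S) (f := l) hxy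
        obtain ⟨t, ht, h0⟩ := hker (s.1 • (x - y)) (by
          rw [map_smul, map_sub, smul_sub, sub_eq_zero]; exact hs)
        refine ⟨⟨t, ht⟩ * s, sub_eq_zero.1 ?_⟩
        rw [← smul_sub, mul_smul]
        exact h0 }
  obtain ⟨g, hg⟩ := hL A B hA hB p hp (IsLocalizedModule.lift S (l ∘ₗ u) h hB ∘ₗ l)
  refine ⟨g ∘ₗ u, fun x => ?_⟩
  rw [LinearMap.comp_apply, hg]
  exact IsLocalizedModule.lift_apply S (l ∘ₗ u) h hB x

/-- Local projectivity makes all higher `Ext` into local modules vanish. -/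
lemma HasLocalLifting.subsingleton_extM (hM : HasLocalLifting S M) {N : Type} [AddCommGroup N]
    [Module R N] (hN : ActsInvertibly S N) (n : ℕ) : Subsingleton (extM R M N (n + 1)) := by
  obtain ⟨⟨P⟩⟩ := (inferInstance : HasProjectiveResolution (ModuleCat.of R M))
  have key : ∀ n, HasLocalLifting S (LinearMap.range (P.complex.d (n + 1) n).hom) ∧
      ∀ f : LinearMap.range (P.complex.d (n + 1) n).hom →ₗ[R] N,
        ∃ ψ : P.complex.X n →ₗ[R] N, ∀ x, ψ x.1 = f x := by
    intro n
    induction n with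
    | zero =>
      rw [range_d_zero]
      exact ⟨hM.ker _ (augmentation_surjective P),
        hM.exists_extend _ (augmentation_surjective P) hN⟩
    | succ n ih =>
      rw [range_d_succ, ← LinearMap.ker_rangeRestrict]
      exact ⟨ih.1.ker _ (LinearMap.surjective_rangeRestrict _),
        ih.1.exists_extend _ (LinearMap.surjective_rangeRestrict _) hN⟩
  exact subsingleton_extM_of_extend P N n (key n).2

end

end LocalModules

section Envelope

variable {R : Type} [CommRing R]

/-- The complement of a maximal `w`-ideal. -/
def maxWCompl (P : {P : Ideal R // IsMaxWIdeal R P}) : Submonoid R :=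
  haveI := P.2.isPrime
  P.1.primeCompl

lemma mem_maxWCompl {P : {P : Ideal R // IsMaxWIdeal R P}} {s : R} :
    s ∈ maxWCompl P ↔ s ∉ P.1 :=
  Iff.rfl

lemma exists_mem_maxWCompl (P : {P : Ideal R // IsMaxWIdeal R P}) {J : Ideal R}
    (hJ : IsGVIdeal R J) : ∃ s ∈ J, s ∈ maxWCompl P :=
  P.2.not_le hJ

/-- An `R`-module is GV-torsion-free when it is a module over the localization at a
maximal `w`-ideal. -/
lemma ActsInvertibly.isGVTorsionFree {P : {P : Ideal R // IsMaxWIdeal R P}} {N : Type}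
    [AddCommGroup N] [Module R N] (hN : ActsInvertibly (maxWCompl P) N) :
    IsGVTorsionFree R N := by
  rintro x ⟨J, hJ, hx⟩
  obtain ⟨s, hsJ, hs⟩ := exists_mem_maxWCompl P hJ
  exact hN.smul_injective hs ((hx s hsJ).trans (smul_zero s).symm)

lemma smul_mem_ker_quotient {J : Ideal R} {Q : Type} [AddCommGroup Q] [Module R Q]
    (π : Q →ₗ[R] R ⧸ J) {s : R} (hs : s ∈ J) (x : Q) : s • x ∈ LinearMap.ker π := by
  rw [LinearMap.mem_ker, map_smul]
  obtain ⟨r, hr⟩ := Ideal.Quotient.mk_surjective (π x)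
  rw [← hr, Algebra.smul_def, Ideal.Quotient.algebraMap_eq, ← map_mul]
  exact Ideal.Quotient.eq_zero_iff_mem.2 (J.mul_mem_right r hs)

lemma subsingleton_extM_one_of_extend {M N : Type} [AddCommGroup M] [Module R M] [AddCommGroup N]
    [Module R N] (h : ∀ (Q : Type) [AddCommGroup Q] [Module R Q] (π : Q →ₗ[R] M)
      (f : LinearMap.ker π →ₗ[R] N), ∃ ψ : Q →ₗ[R] N, ∀ x : LinearMap.ker π, ψ x = f x) :
    Subsingleton (extM R M N 1) := by
  obtain ⟨⟨P⟩⟩ := (inferInstance : HasProjectiveResolution (ModuleCat.of R M))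
  refine subsingleton_extM_of_extend P N 0 ?_
  rw [range_d_zero]
  exact h _ (augmentation P)

lemma ActsInvertibly.isWModule {P : {P : Ideal R // IsMaxWIdeal R P}} {N : Type}
    [AddCommGroup N] [Module R N] (hN : ActsInvertibly (maxWCompl P) N) : IsWModule R N := by
  refine ⟨hN.isGVTorsionFree, fun J hJ => subsingleton_extM_one_of_extend fun Q _ _ π f => ?_⟩
  obtain ⟨s, hsJ, hs⟩ := exists_mem_maxWCompl P hJ
  exact hN.exists_extend _ hs (smul_mem_ker_quotient π hsJ) f

variable (R) (M : Type) [AddCommGroup M] [Module R M]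

/-- The map from `M` to the product of its localizations at the maximal `w`-ideals. -/
noncomputable def toProdLocalized :
    M →ₗ[R] ∀ P : {P : Ideal R // IsMaxWIdeal R P}, LocalizedModule (maxWCompl P) M :=
  LinearMap.pi fun P => LocalizedModule.mkLinearMap (maxWCompl P) M

variable {R M} in
lemma toProdLocalized_eq_zero_iff {x : M} :
    toProdLocalized R M x = 0 ↔ ∀ P : {P : Ideal R // IsMaxWIdeal R P}, ∃ s ∈ maxWCompl P,
      s • x = 0 := by
  rw [funext_iff]
  refine forall_congr' fun P => ?_
  have := IsLocalizedModule.eq_zero_iff (maxWCompl P)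
    (LocalizedModule.mkLinearMap (maxWCompl P) M) (m := x)
  exact this.trans ⟨fun ⟨s, hs⟩ => ⟨s, s.2, hs⟩, fun ⟨s, hs, h⟩ => ⟨⟨s, hs⟩, h⟩⟩

lemma ker_toProdLocalized : LinearMap.ker (toProdLocalized R M) = torGV R M := by
  refine le_antisymm (fun x hx => Submodule.subset_span ?_) (Submodule.span_le.2 ?_)
  · obtain ⟨J, hJ, hle⟩ := exists_isGVIdeal_le (LinearMap.ker (LinearMap.toSpanSingleton R M x))
      fun P hP => by
        obtain ⟨s, hs, h⟩ := toProdLocalized_eq_zero_iff.1 hx ⟨P, hP⟩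
        exact ⟨s, h, hs⟩
    exact ⟨J, hJ, hle⟩
  · rintro x ⟨J, hJ, hx⟩
    refine toProdLocalized_eq_zero_iff.2 fun P => ?_
    obtain ⟨s, hsJ, hs⟩ := exists_mem_maxWCompl P hJ
    exact ⟨s, hs, hx s hsJ⟩

/-- The elements of the product of the localizations that come from `M` up to GV-torsion. -/
noncomputable def wClosure :
    Submodule R (∀ P : {P : Ideal R // IsMaxWIdeal R P}, LocalizedModule (maxWCompl P) M) where
  carrier := {y | ∀ P, ∃ s ∈ maxWCompl P, s • y ∈ LinearMap.range (toProdLocalized R M)}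
  zero_mem' := fun P => ⟨(1 : R), one_mem _, by simp⟩
  add_mem' := fun {x y} hx hy P => by
    obtain ⟨s, hs, h⟩ := hx P
    obtain ⟨t, ht, h'⟩ := hy P
    refine ⟨s * t, mul_mem hs ht, ?_⟩
    rw [smul_add, mul_smul, smul_comm, mul_smul]
    exact Submodule.add_mem _ (Submodule.smul_mem _ t h) (Submodule.smul_mem _ s h')
  smul_mem' := fun r x hx P => by
    obtain ⟨s, hs, h⟩ := hx P
    exact ⟨s, hs, by rw [smul_comm]; exact Submodule.smul_mem _ r h⟩

/-- The map from `M` to its `w`-closure. -/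
noncomputable def toWClosure : M →ₗ[R] wClosure R M :=
  (toProdLocalized R M).codRestrict _ fun x _ => ⟨(1 : R), one_mem _, by rw [one_smul]; exact ⟨x, rfl⟩⟩

lemma isWModule_wClosure : IsWModule R (wClosure R M) := by
  constructor
  · rintro x ⟨J, hJ, hx⟩
    refine Subtype.ext (funext fun P => ?_)
    exact (actsInvertibly_localizedModule (maxWCompl P) M).isGVTorsionFree _
      ⟨J, hJ, fun j hj => congrFun (congrArg Subtype.val (hx j hj)) P⟩
  · refine fun J hJ => subsingleton_extM_one_of_extend fun Q _ _ π f => ?_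
    have h (P : {P : Ideal R // IsMaxWIdeal R P}) :
        ∃ ψ : Q →ₗ[R] LocalizedModule (maxWCompl P) M,
          ∀ x : LinearMap.ker π, ψ x = (f x).1 P := by
      obtain ⟨s, hsJ, hs⟩ := exists_mem_maxWCompl P hJ
      exact (actsInvertibly_localizedModule (maxWCompl P) M).exists_extend _ hs
        (smul_mem_ker_quotient π hsJ) (LinearMap.proj P ∘ₗ (wClosure R M).subtype ∘ₗ f)
    choose ψ hψ using h
    have hψ' (x : LinearMap.ker π) : LinearMap.pi ψ x.1 = (f x).1 := funext fun P => hψ P x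
    refine ⟨(LinearMap.pi ψ).codRestrict _ fun x P => ?_, fun x => Subtype.ext (hψ' x)⟩
    obtain ⟨s, hsJ, hs⟩ := exists_mem_maxWCompl P hJ
    obtain ⟨t, ht, h⟩ := (f ⟨_, smul_mem_ker_quotient π hsJ x⟩).2 P
    refine ⟨t * s, mul_mem ht hs, ?_⟩
    rw [mul_smul, ← map_smul (LinearMap.pi ψ)]
    rwa [← hψ'] at h

/-- The canonical `w`-envelope of `M / tor_GV(M)`. -/
lemma isWEnvelope_wClosure :
    IsWEnvelope R (M ⧸ torGV R M) (wClosure R M)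
      ((torGV R M).liftQ (toWClosure R M) (by
        rw [← ker_toProdLocalized]
        exact fun x hx => Subtype.ext hx)) := by
  refine ⟨isWModule_wClosure R M, ?_, ?_⟩
  · rw [← LinearMap.ker_eq_bot]
    refine Submodule.ker_liftQ_eq_bot _ _ _ ?_
    rw [← ker_toProdLocalized]
    exact fun x hx => congrArg Subtype.val hx
  · intro x
    obtain ⟨y, rfl⟩ := Submodule.Quotient.mk_surjective _ x
    rw [Submodule.range_liftQ]
    obtain ⟨J, hJ, hle⟩ := exists_isGVIdeal_le
      ((LinearMap.range (toWClosure R M)).comap (LinearMap.toSpanSingleton R _ y)) fun P hP => by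
        obtain ⟨s, hs, z, hz⟩ := y.2 ⟨P, hP⟩
        exact ⟨s, ⟨z, Subtype.ext hz⟩, hs⟩
    refine ⟨J, hJ, fun j hj => ?_⟩
    rw [← Submodule.Quotient.mk_smul, Submodule.Quotient.mk_eq_zero]
    exact hle hj

variable {R M}

/-- `w`-projective modules are locally projective at the maximal `w`-ideals. -/
lemma IsWProjective.hasLocalLifting (hM : IsWProjective R M)
    (P : {P : Ideal R // IsMaxWIdeal R P}) : HasLocalLifting (maxWCompl P) M := by
  have hL : HasLocalLifting (maxWCompl P) (wClosure R M) := by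
    obtain ⟨⟨X⟩⟩ := (inferInstance : HasProjectiveResolution (ModuleCat.of R (wClosure R M)))
    refine hasLocalLifting_of_extend _ (augmentation_surjective X) fun N _ _ hN f => ?_
    obtain ⟨z, hz⟩ := exists_extend_smul X N f
    obtain ⟨J, hJ, hJz⟩ := hM N hN.isGVTorsionFree hN.isWModule _ _ (isWEnvelope_wClosure R M) z
    obtain ⟨s, hsJ, hs⟩ := exists_mem_maxWCompl P hJ
    obtain ⟨ψ, hψ⟩ := hz s (hJz s hsJ)
    obtain ⟨u, hu⟩ := hN.exists_inv hs
    exact ⟨u ∘ₗ ψ, fun x => by rw [LinearMap.comp_apply, hψ, (hu _).1]⟩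
  refine hL.of_map (toWClosure R M) (fun x hx => ?_) fun y => ?_
  · exact toProdLocalized_eq_zero_iff.1 (congrArg Subtype.val hx) P
  · obtain ⟨s, hs, x, hx⟩ := y.2 P
    exact ⟨s, hs, x, Subtype.ext hx.symm⟩

lemma ActsInvertibly.memPwDaggerInfty {P : {P : Ideal R // IsMaxWIdeal R P}} {N : Type}
    [AddCommGroup N] [Module R N] (hN : ActsInvertibly (maxWCompl P) N) :
    MemPwDaggerInfty R N := by
  refine ⟨hN.isGVTorsionFree, fun M _ _ hM k hk => ?_⟩
  obtain ⟨n, rfl⟩ := Nat.exists_eq_add_of_le' hk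
  exact (hM.hasLocalLifting P).subsingleton_extM hN n

end Envelope

section VonNeumannRegular

variable {R : Type} [CommRing R]

open scoped TensorProduct

lemma finitePresentation_quotient_span_singleton (a : R) :
    Module.FinitePresentation R (R ⧸ Ideal.span {a}) :=
  Module.finitePresentation_of_surjective (Ideal.span {a}).mkQ (Submodule.mkQ_surjective _) <| by
    rw [Submodule.ker_mkQ]
    exact Submodule.fg_span_singleton a

/-- The residue field at a maximal `w`-ideal. -/
lemma actsInvertibly_residueField (P : {P : Ideal R // IsMaxWIdeal R P}) [P.1.IsPrime] :
    ActsInvertibly (maxWCompl P) P.1.ResidueField := by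
  refine fun s => (Module.End.isUnit_iff _).2 ?_
  have hs : algebraMap R P.1.ResidueField s ≠ 0 := fun h =>
    s.2 (Ideal.algebraMap_residueField_eq_zero.1 h)
  refine ⟨fun x y hxy => mul_left_cancel₀ hs ?_, fun y =>
    ⟨(algebraMap R P.1.ResidueField s)⁻¹ * y, ?_⟩⟩
  · rw [← Algebra.smul_def, ← Algebra.smul_def]
    exact hxy
  · rw [Module.algebraMap_end_apply, Algebra.smul_def, mul_inv_cancel_left₀ hs]

/-- If `R ⧸ (a)` has no first extension by the residue field of a prime containing `a`, then `a`
vanishes locally at this prime. -/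
lemma exists_notMem_mul_eq_zero (P : Ideal R) [P.IsPrime] {a : R} (ha : a ∈ P)
    (h : Subsingleton (extM R (R ⧸ Ideal.span {a}) P.ResidueField 1)) :
    ∃ s, s ∉ P ∧ s * a = 0 := by
  by_contra! hann
  obtain ⟨⟨X⟩⟩ := (inferInstance : HasProjectiveResolution (ModuleCat.of R (R ⧸ Ideal.span {a})))
  obtain ⟨g, hg⟩ := Module.projective_lifting_property (Ideal.span {a}).mkQ (augmentation X)
    (Submodule.mkQ_surjective _)
  have hg' (x : X.complex.X 0) : (Ideal.span {a}).mkQ (g x) = augmentation X x :=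
    LinearMap.congr_fun hg x
  obtain ⟨k, hk⟩ := exists_factor_range (LinearMap.toSpanSingleton R R a)
    (Algebra.linearMap R P.ResidueField) fun r hr => by
      by_contra hr'
      exact hann r (fun hrP => hr' (Ideal.algebraMap_residueField_eq_zero.2 hrP)) hr
  let f : LinearMap.ker (augmentation X) →ₗ[R] P.ResidueField :=
    k ∘ₗ (g ∘ₗ (LinearMap.ker (augmentation X)).subtype).codRestrict _ fun x => by
      have hx : g x ∈ Ideal.span {a} :=
        (Submodule.Quotient.mk_eq_zero _).1 ((hg' x).trans x.2)
      obtain ⟨r, hr⟩ := Ideal.mem_span_singleton'.1 hx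
      exact ⟨r, hr⟩
  have hf (x : LinearMap.ker (augmentation X)) (r : R) (hr : g x = r * a) :
      f x = algebraMap R P.ResidueField r :=
    (congrArg k (Subtype.ext hr)).trans (hk r)
  obtain ⟨z, hz⟩ := exists_extend_smul X P.ResidueField f
  obtain ⟨ψ, hψ⟩ := hz 1 (Subsingleton.elim _ _)
  obtain ⟨x, hx⟩ := augmentation_surjective X (Submodule.Quotient.mk 1)
  have h1 : g x - 1 ∈ Ideal.span {a} := (Submodule.Quotient.eq _).1 ((hg' x).trans hx)
  obtain ⟨t, ht⟩ := Ideal.mem_span_singleton'.1 h1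
  have hax : a • x ∈ LinearMap.ker (augmentation X) := by
    rw [LinearMap.mem_ker, map_smul, hx, ← Submodule.Quotient.mk_smul, Submodule.Quotient.mk_eq_zero,
      smul_eq_mul, mul_one]
    exact Ideal.mem_span_singleton_self a
  have h2 := hf ⟨a • x, hax⟩ (1 + t * a) (by
    rw [map_smul, smul_eq_mul]
    linear_combination -a * ht)
  have ha0 : algebraMap R P.ResidueField a = 0 := Ideal.algebraMap_residueField_eq_zero.2 ha
  have h3 := hψ ⟨a • x, hax⟩
  rw [one_smul, h2, map_smul, Algebra.smul_def, ha0, map_add, map_mul, ha0, map_one] at h3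
  simp at h3

/-- If `R ⧸ (a)` is `w`-flat, then `a` is a multiple of `a ^ 2` locally at the maximal
`w`-ideals. -/
lemma IsWFlat.exists_mul_eq {a : R} (h : IsWFlat R (R ⧸ Ideal.span {a})) (P : Ideal R)
    (hP : IsMaxWIdeal R P) : ∃ s, s ∉ P ∧ ∃ t, s * a = a ^ 2 * t := by
  have := hP.isPrime
  have hinj := h _ _ (Ideal.span {a}).subtype
    (fun P _ _ => IsLocalizedModule.map_injective P.primeCompl _ _ _ Subtype.val_injective) P hP
  let a' : Ideal.span {a} := ⟨a, Ideal.mem_span_singleton_self a⟩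
  have h0 : LinearMap.lTensor (R ⧸ Ideal.span {a}) (Ideal.span {a}).subtype
      ((1 : R ⧸ Ideal.span {a}) ⊗ₜ[R] a') = 0 := by
    rw [LinearMap.lTensor_tmul, Submodule.subtype_apply,
      show (a'.1 : R) = a • (1 : R) by simp [a'], ← TensorProduct.smul_tmul,
      Algebra.smul_def, mul_one, Ideal.Quotient.algebraMap_eq, Ideal.Quotient.eq_zero_iff_mem.2 a'.2,
      TensorProduct.zero_tmul]
  have h1 : LocalizedModule.mkLinearMap P.primeCompl _ ((1 : R ⧸ Ideal.span {a}) ⊗ₜ[R] a') = 0 := by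
    refine hinj ?_
    rw [map_zero, locMap, IsLocalizedModule.map_apply, h0, map_zero]
  obtain ⟨s, hs⟩ := (IsLocalizedModule.eq_zero_iff P.primeCompl _).1 h1
  refine ⟨s, s.2, ?_⟩
  have h2 := congrArg (TensorProduct.quotTensorEquivQuotSMul (Ideal.span {a}) (Ideal.span {a})) hs
  rw [Submonoid.smul_def, map_smul, TensorProduct.quotTensorEquivQuotSMul_mk_one_tmul, map_zero,
    ← Submodule.Quotient.mk_smul, Submodule.Quotient.mk_eq_zero] at h2
  have h3 := Submodule.mem_map_of_mem (f := (Ideal.span {a}).subtype) h2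
  rw [Submodule.map_smul'', Submodule.map_top, Submodule.range_subtype, smul_eq_mul,
    Ideal.span_singleton_mul_span_singleton] at h3
  obtain ⟨t, ht⟩ := Ideal.mem_span_singleton'.1 h3
  exact ⟨t, (ht.symm.trans (by ring) : (s : R) * a = a ^ 2 * t)⟩

/-- Modules over a von Neumann regular ring are flat. -/
lemma flat_of_forall_eq_mul_mul_self (h : ∀ a : R, ∃ b, a = a * b * a) (M : Type*)
    [AddCommGroup M] [Module R M] : Module.Flat R M := by
  refine Module.Flat.iff_rTensor_injective.2 fun I hI => ?_
  have hII : IsIdempotentElem I := by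
    refine le_antisymm Ideal.mul_le_left fun a ha => ?_
    obtain ⟨b, hb⟩ := h a
    rw [hb]
    exact Ideal.mul_mem_mul (I.mul_mem_right b ha) ha
  obtain ⟨e, he, rfl⟩ := (Ideal.isIdempotentElem_iff_of_fg I hI).1 hII
  have hr : LinearMap.toSpanSingleton R (R ∙ e) ⟨e, Submodule.mem_span_singleton_self e⟩ ∘ₗ
      Submodule.subtype (R ∙ e) = LinearMap.id := by
    ext ⟨x, hx⟩
    obtain ⟨r, rfl⟩ := Submodule.mem_span_singleton.1 hx
    simp [mul_assoc, he.eq]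
  refine Function.LeftInverse.injective (g := LinearMap.rTensor M
    (LinearMap.toSpanSingleton R _ ⟨e, Submodule.mem_span_singleton_self e⟩)) fun x => ?_
  rw [← LinearMap.comp_apply, ← LinearMap.rTensor_comp, hr, LinearMap.rTensor_id, LinearMap.id_apply]

/-- Flat modules are `w`-flat. -/
lemma isWFlat_of_flat (M : Type) [AddCommGroup M] [Module R M] [Module.Flat R M] :
    IsWFlat R M := by
  intro A B _ _ _ _ f hf P hP _
  have hker (x : A) (hx : f x = 0) : ∃ s ∈ P.primeCompl, s • x = 0 := by
    have : LocalizedModule.mkLinearMap P.primeCompl A x = 0 := hf P hP <| by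
      rw [map_zero, locMap, IsLocalizedModule.map_apply, hx, map_zero]
    obtain ⟨s, hs⟩ := (IsLocalizedModule.eq_zero_iff P.primeCompl _).1 this
    exact ⟨s, s.2, hs⟩
  have htens (y : M ⊗[R] LinearMap.ker f) : ∃ s ∈ P.primeCompl, s • y = 0 := by
    induction y with
    | zero => exact ⟨1, one_mem _, smul_zero _⟩
    | tmul m x =>
      obtain ⟨s, hs, h⟩ := hker x x.2
      refine ⟨s, hs, ?_⟩
      rw [← TensorProduct.tmul_smul, (Subtype.ext h : s • x = 0), TensorProduct.tmul_zero]
    | add y z hy hz =>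
      obtain ⟨s, hs, h⟩ := hy
      obtain ⟨t, ht, h'⟩ := hz
      refine ⟨s * t, mul_mem hs ht, ?_⟩
      rw [smul_add, mul_smul s t z, h', smul_zero, mul_comm, mul_smul, h, smul_zero, add_zero]
  have hex : Function.Exact (LinearMap.lTensor M (LinearMap.ker f).subtype)
      (LinearMap.lTensor M f) :=
    Module.Flat.lTensor_exact M (LinearMap.exact_subtype_ker_map f)
  refine (injective_iff_map_eq_zero _).2 fun y hy => ?_
  obtain ⟨⟨x, s⟩, hx⟩ :=
    IsLocalizedModule.surj P.primeCompl (LocalizedModule.mkLinearMap P.primeCompl (M ⊗[R] A)) y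
  have h1 : LocalizedModule.mkLinearMap P.primeCompl _ (LinearMap.lTensor M f x) = 0 := by
    rw [← IsLocalizedModule.map_apply P.primeCompl
      (LocalizedModule.mkLinearMap P.primeCompl (M ⊗[R] A)), ← hx, Submonoid.smul_def, map_smul]
    exact (congrArg (s.1 • ·) hy).trans (smul_zero _)
  obtain ⟨t, ht⟩ := (IsLocalizedModule.eq_zero_iff P.primeCompl _).1 h1
  obtain ⟨z, hz⟩ := (hex (t • x)).1 (by rw [Submonoid.smul_def, map_smul]; exact ht)
  obtain ⟨u, hu, h⟩ := htens z
  have hinv := actsInvertibly_localizedModule P.primeCompl (M ⊗[R] A)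
  refine hinv.smul_injective s.2 (hinv.smul_injective t.2 (hinv.smul_injective hu ?_))
  rw [smul_zero, smul_zero, smul_zero]
  have h2 : (t.1 • s.1 • y) = LocalizedModule.mkLinearMap P.primeCompl _ (t • x) := by
    rw [Submonoid.smul_def, map_smul]
    exact congrArg (t.1 • ·) hx
  rw [h2, ← hz, ← map_smul, ← map_smul, h, map_zero, map_zero]

lemma subsingleton_extM_of_projective (M N : Type) [AddCommGroup M] [Module R M]
    [Module.Projective R M] [AddCommGroup N] [Module R N] (n : ℕ) :
    Subsingleton (extM R M N (n + 1)) := by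
  have : Projective (ModuleCat.of R M) := (IsProjective.iff_projective _).1 ‹_›
  exact ModuleCat.subsingleton_of_isZero
    (isZero_Ext_succ_of_projective (R := R) (ModuleCat.of R M) (ModuleCat.of R N) n)

end VonNeumannRegular

/-- characterizations of von Neumann regular rings. -/
theorem tfae_vonNeumannRegular (R : Type) [CommRing R] :
    List.TFAE
      [∀ (M : Type) [AddCommGroup M] [Module R M],
          IsFPProjective R M → IsWeakWProjective R M,
        ∀ (M : Type) [AddCommGroup M] [Module R M],
          Module.FinitePresentation R M → IsWeakWProjective R M,
        ∀ (M : Type) [AddCommGroup M] [Module R M],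
          Module.FinitePresentation R M → IsWFlat R M,
        ∀ a : R, ∃ b : R, a = a * b * a] := by
  tfae_have 1 → 2 := fun h M _ _ hM => h M fun N _ _ hN => hN M hM
  tfae_have 2 → 4 := fun h a => exists_eq_mul_mul_self a fun P hP => by
    have := hP.isPrime
    by_cases ha : a ∈ P
    · obtain ⟨s, hs, h0⟩ := exists_notMem_mul_eq_zero P ha <|
        h _ (finitePresentation_quotient_span_singleton a) P.ResidueField
          (actsInvertibly_residueField ⟨P, hP⟩).memPwDaggerInfty
      exact ⟨s, hs, 0, by rw [h0, mul_zero]⟩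
    · exact ⟨a, ha, 1, by ring⟩
  tfae_have 3 → 4 := fun h a => exists_eq_mul_mul_self a
    (h _ (finitePresentation_quotient_span_singleton a)).exists_mul_eq
  tfae_have 4 → 3 := fun h M _ _ _ =>
    have := flat_of_forall_eq_mul_mul_self h M
    isWFlat_of_flat M
  tfae_have 4 → 1 := fun h M _ _ hM N _ _ _ => hM N fun F _ _ _ =>
    have := flat_of_forall_eq_mul_mul_self h F
    have : Module.Projective R F := Module.Flat.projective_of_finitePresentation
    subsingleton_extM_of_projective F N 0
  tfae_finish
end

section
/- Let R be an integral domain and J a proper GV-ideal of R (J ≠ R). Then the R-module M = R ⊕ R/J is weak w-projective but not torsion-free (i.e., there exist a nonzero r ∈ R and a nonzero x ∈ M with r x = 0). -/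
/-!  Background definitions for the `w`-operation theory of Wang–Kim–Qiao.  -/

open CategoryTheory

section GVModules

variable {R : Type} [CommRing R]

theorem IsGVIdeal.ne_bot [Nontrivial R] {J : Ideal R} (hJ : IsGVIdeal R J) : J ≠ ⊥ := by
  rintro rfl
  refine one_ne_zero (hJ.2.1 (a₁ := (1 : R)) (a₂ := 0) ?_)
  ext ⟨x, hx⟩
  simp [(Submodule.mem_bot R).1 hx]

theorem IsGVIdeal.exists_ne_zero [Nontrivial R] {J : Ideal R} (hJ : IsGVIdeal R J) :
    ∃ r ∈ J, r ≠ 0 :=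
  Submodule.exists_mem_ne_zero_of_ne_bot hJ.ne_bot

/-- `Ext^1` out of a projective module vanishes. -/
theorem subsingleton_extM_one_of_projective (L N : Type) [AddCommGroup L] [Module R L]
    [AddCommGroup N] [Module R N] [Module.Projective R L] : Subsingleton (extM R L N 1) := by
  have : Projective (ModuleCat.of R L) := (IsProjective.iff_projective L).1 inferInstance
  exact ModuleCat.subsingleton_of_isZero
    (isZero_Ext_succ_of_projective (ModuleCat.of R L) (ModuleCat.of R N) 0)

/-- An injective map from `R` into a GV-torsion-free module with GV-torsion cokernel
is surjective. -/
theorem surjective_of_isGVTorsion_coker {L : Type} [AddCommGroup L] [Module R L]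
    (f : R →ₗ[R] L) (hL : IsGVTorsionFree R L) (hf : Function.Injective f)
    (hc : IsGVTorsion R (L ⧸ LinearMap.range f)) : Function.Surjective f := by
  intro x
  obtain ⟨I, hI, hIx⟩ := hc (Submodule.Quotient.mk x)
  have hmem : ∀ j : I, (LinearMap.toSpanSingleton R L x ∘ₗ I.subtype) j ∈ LinearMap.range f := by
    intro j
    rw [← Submodule.Quotient.mk_eq_zero]
    exact hIx j j.2
  let g : I →ₗ[R] R := (LinearEquiv.ofInjective f hf).symm.toLinearMap ∘ₗ
    LinearMap.codRestrict (LinearMap.range f) _ hmem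
  have hg : ∀ j : I, f (g j) = (j : R) • x := fun j =>
    congrArg Subtype.val ((LinearEquiv.ofInjective f hf).apply_symm_apply _)
  obtain ⟨r, hr⟩ := hI.2.2 g
  refine ⟨r, sub_eq_zero.1 (hL _ ⟨I, hI, fun j hj => ?_⟩)⟩
  have h := hg ⟨j, hj⟩
  rw [← hr] at h
  rw [smul_sub, ← h, ← map_smul, sub_eq_zero]
  simp [mul_comm]

/-- A module whose quotient by its GV-torsion submodule is `R` is `w`-projective, as soon as
`R` has a GV-ideal. -/
theorem isWProjective_of_equiv {M : Type} [AddCommGroup M] [Module R M] {J : Ideal R}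
    (hJ : IsGVIdeal R J) (e : (M ⧸ torGV R M) ≃ₗ[R] R) : IsWProjective R M := by
  intro N _ _ _ _ L _ _ ι hι
  have hinj : Function.Injective (ι ∘ₗ e.symm.toLinearMap) :=
    hι.2.1.comp e.symm.injective
  have hrange : LinearMap.range (ι ∘ₗ e.symm.toLinearMap) = LinearMap.range ι :=
    LinearMap.range_comp_of_range_eq_top _ e.symm.range
  have hsurj := surjective_of_isGVTorsion_coker _ hι.1.1 hinj (by rw [hrange]; exact hι.2.2)
  have : Module.Projective R L :=
    Module.Projective.of_equiv (LinearEquiv.ofBijective _ ⟨hinj, hsurj⟩)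
  have := subsingleton_extM_one_of_projective (R := R) L N
  exact fun x => ⟨J, hJ, fun j _ => Subsingleton.elim _ _⟩

/-- Over a domain, the GV-torsion submodule of `R ⊕ R/J` is `R/J`. -/
theorem torGV_prod_quotient [IsDomain R] {J : Ideal R} (hJ : IsGVIdeal R J) :
    torGV R (R × (R ⧸ J)) = LinearMap.ker (LinearMap.fst R R (R ⧸ J)) := by
  apply le_antisymm
  · refine Submodule.span_le.2 ?_
    rintro ⟨a, b⟩ ⟨I, hI, h⟩
    obtain ⟨r, hr, hr0⟩ := hI.exists_ne_zero
    have : r * a = 0 := congrArg Prod.fst (h r hr)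
    simpa [hr0] using this
  · rintro ⟨a, b⟩ h
    obtain rfl : a = 0 := h
    refine Submodule.subset_span ⟨J, hJ, fun j hj => ?_⟩
    obtain ⟨c, rfl⟩ := Ideal.Quotient.mk_surjective b
    refine Prod.ext (mul_zero j) ?_
    exact Ideal.Quotient.eq_zero_iff_mem.2 (J.mul_mem_right c hj)

theorem IsWProjective.isWeakWProjective {M : Type} [AddCommGroup M] [Module R M]
    (hM : IsWProjective R M) : IsWeakWProjective R M :=
  fun _ _ _ hN => hN.2 M hM 1 le_rfl

end GVModules

/-- over an integral domain `R` with a proper GV-ideal `J`, the module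
`M = R ⊕ R/J` is weak `w`-projective but not torsion-free. -/
theorem weakWProjective_not_torsionFree (R : Type) [CommRing R] [IsDomain R]
    (J : Ideal R) (hJ : IsGVIdeal R J) (hJne : J ≠ ⊤) :
    IsWeakWProjective R (R × (R ⧸ J)) ∧
      ∃ (r : R) (x : R × (R ⧸ J)), r ≠ 0 ∧ x ≠ 0 ∧ r • x = 0 := by
  refine ⟨IsWProjective.isWeakWProjective (isWProjective_of_equiv hJ
    ((Submodule.quotEquivOfEq _ _ (torGV_prod_quotient hJ)).trans
      (LinearMap.quotKerEquivOfSurjective _ LinearMap.fst_surjective))), ?_⟩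
  obtain ⟨r, hr, hr0⟩ := hJ.exists_ne_zero
  have : Nontrivial (R ⧸ J) := Ideal.Quotient.nontrivial_iff.2 hJne
  refine ⟨r, (0, 1), hr0, fun h => one_ne_zero (congrArg Prod.snd h), Prod.ext (mul_zero r) ?_⟩
  change Ideal.Quotient.mk J (r * 1) = 0
  exact Ideal.Quotient.eq_zero_iff_mem.2 (J.mul_mem_right 1 hr)
end
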